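/- (Estimation Theorem) Let d ≥ 1 be an integer and let w : ℕ → [0,∞) satisfy ∑_{j=0}^∞ 2^{−dj}·⌊w(j)⌋ < ∞. Let π be a probability measure on [0,1]^d × {−1,1} satisfying (A1) with constants a, A and (SMA) with constant h, and whose Bayes rule f* belongs to F_w^(d). For ε > 0 let J_ε be the smallest nonnegative integer J with ∑_{j=J+1}^∞ 2^{−dj}·⌊w(j)⌋ < ε/A. Then for every n ≥ 1 and every ε > 0, the classifier f̂_n^{(J_ε)} built from an i.i.d. sample of size n from π satisfies E_{π^⊗n}[R(f̂_n^{(J_ε)}) − R(f*)] ≤ (1+A)·ε + exp(−n·a·(1 − exp(−h²/2))·2^{−d·J_ε}). -/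

import Mathlib

open MeasureTheory Set
open scoped ENNReal

noncomputable section

/-- Points of `ℝ^d`. -/
abbrev Pt (d : ℕ) : Type := Fin d → ℝ

/-- The unit cube `[0,1]^d`. -/
def unitCube (d : ℕ) : Set (Pt d) := Set.Icc 0 1

/-- Lebesgue measure `λ_d` on `[0,1]^d`. -/
def lamd (d : ℕ) : Measure (Pt d) := volume.restrict (unitCube d)

/-- The dyadic subinterval of `[0,1]` at level `j` with index `k`:
`[k 2^{-j}, (k+1) 2^{-j})` for `k < 2^j - 1` and `[1 - 2^{-j}, 1]` for `k = 2^j - 1`. -/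
def dyadicI (j k : ℕ) : Set ℝ :=
  if k = 2 ^ j - 1 then Set.Icc (1 - ((2 : ℝ) ^ j)⁻¹) 1
  else Set.Ico ((k : ℝ) / 2 ^ j) (((k : ℝ) + 1) / 2 ^ j)

/-- The dyadic cube `I_k^{(j)} ⊆ [0,1]^d` at level `j` with multi-index `k`. -/
def dyadicCube (d j : ℕ) (k : Fin d → ℕ) : Set (Pt d) :=
  {x | ∀ i, x i ∈ dyadicI j (k i)}

/-- `f` is represented by the (automatically countable) family `T` of pairwise disjoint
dyadic cubes whose union has full Lebesgue measure in `[0,1]^d`, with `f` constant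
on each cube of the family. -/
def IsDyadicRep (d : ℕ) (f : Pt d → ℝ) (T : Set (ℕ × (Fin d → ℕ))) : Prop :=
  (∀ p ∈ T, ∀ i, p.2 i < 2 ^ p.1) ∧
  (T.PairwiseDisjoint fun p => dyadicCube d p.1 p.2) ∧
  lamd d (unitCube d \ ⋃ p ∈ T, dyadicCube d p.1 p.2) = 0 ∧
  (∀ p ∈ T, ∀ x ∈ dyadicCube d p.1 p.2, ∀ y ∈ dyadicCube d p.1 p.2, f x = f y)

/-- The class `F^(d)` of measurable `{-1,1}`-valued functions admitting a dyadic
representation. -/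
def memF (d : ℕ) (f : Pt d → ℝ) : Prop :=
  Measurable f ∧ (∀ x, f x = 1 ∨ f x = -1) ∧ ∃ T, IsDyadicRep d f T

/-- The class `F_w^(d)`: a dyadic representation with at most `w j` cubes of side
`2^{-j}` for every level `j`. -/
def memFw (d : ℕ) (w : ℕ → ℝ) (f : Pt d → ℝ) : Prop :=
  Measurable f ∧ (∀ x, f x = 1 ∨ f x = -1) ∧
    ∃ T, IsDyadicRep d f T ∧
      ∀ j, ((T ∩ {p | p.1 = j}).encard : ℝ≥0∞) ≤ ENNReal.ofReal (w j)

/-- Marginal `P^X` of `π` on `[0,1]^d`. -/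
def margX {d : ℕ} (π : Measure (Pt d × ℝ)) : Measure (Pt d) := π.map Prod.fst

/-- The labels of `π` lie in `{-1, 1}` almost surely. -/
def Labels {d : ℕ} (π : Measure (Pt d × ℝ)) : Prop := π {p | p.2 = 1 ∨ p.2 = -1} = 1

/-- `η` is the regression function (conditional probability of `Y = 1`) of `π`. -/
def IsRegression {d : ℕ} (π : Measure (Pt d × ℝ)) (η : Pt d → ℝ) : Prop :=
  Measurable η ∧ (∀ x, η x ∈ Set.Icc (0 : ℝ) 1) ∧
    ∀ s : Set (Pt d), MeasurableSet s →
      π (s ×ˢ {(1 : ℝ)}) = ∫⁻ x in s, ENNReal.ofReal (η x) ∂(margX π)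

/-- The Bayes rule `f*` associated with the regression function `η`. -/
def bayes {d : ℕ} (η : Pt d → ℝ) (x : Pt d) : ℝ := if 1 / 2 ≤ η x then 1 else -1

/-- Misclassification risk `R(f) = π({(x,y) : f(x) ≠ y})`. -/
def risk {d : ℕ} (π : Measure (Pt d × ℝ)) (f : Pt d → ℝ) : ℝ :=
  (π {p | f p.1 ≠ p.2}).toReal

/-- Assumption (A1): `P^X` is absolutely continuous w.r.t. `λ_d` with density
between `a` and `A`. -/
def A1cond {d : ℕ} (π : Measure (Pt d × ℝ)) (a A : ℝ) : Prop :=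
  ∀ s : Set (Pt d), MeasurableSet s →
    ENNReal.ofReal a * lamd d s ≤ margX π s ∧ margX π s ≤ ENNReal.ofReal A * lamd d s

/-- Strong margin assumption (SMA) with margin `h`. -/
def SMAcond {d : ℕ} (π : Measure (Pt d × ℝ)) (η : Pt d → ℝ) (h : ℝ) : Prop :=
  margX π {x | h ≤ |2 * η x - 1|} = 1

/-- Number of indices `i` satisfying `P i`. -/
def cnt (n : ℕ) (P : Fin n → Prop) : ℕ := Nat.card {i // P i}

/-- Index of the level-`J` dyadic interval containing `t ∈ [0,1]`. -/
def dyadicIdx (J : ℕ) (t : ℝ) : ℕ := min ⌊t * 2 ^ J⌋₊ (2 ^ J - 1)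

/-- The level-`J` dyadic cube containing `x ∈ [0,1]^d`. -/
def cubeOf (d J : ℕ) (x : Pt d) : Set (Pt d) := dyadicCube d J fun i => dyadicIdx J (x i)

open Classical in
/-- The dyadic majority-vote classifier `f̂_n^{(J)}` built from the sample `s`. -/
def fhat (d J n : ℕ) (s : Fin n → Pt d × ℝ) (x : Pt d) : ℝ :=
  if (∃ i, (s i).1 ∈ cubeOf d J x) ∧
      cnt n (fun i => (s i).1 ∈ cubeOf d J x ∧ (s i).2 = -1) <
        cnt n (fun i => (s i).1 ∈ cubeOf d J x ∧ (s i).2 = 1)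
  then 1 else -1

/-- The `n`-fold product measure `π^{⊗n}` governing the i.i.d. sample. -/
def sampM {d : ℕ} (π : Measure (Pt d × ℝ)) [SigmaFinite π] (n : ℕ) :
    Measure (Fin n → Pt d × ℝ) := Measure.pi fun _ => π

/-- Expected excess risk `E_{π^{⊗n}}[R(f̂_n) - R(f*)]` of the classifier `F`. -/
def excessExp {d : ℕ} (π : Measure (Pt d × ℝ)) [SigmaFinite π] (η : Pt d → ℝ) (n : ℕ)
    (F : (Fin n → Pt d × ℝ) → Pt d → ℝ) : ℝ :=
  ∫ s, risk π (F s) ∂(sampM π n) - risk π (bayes η)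

/-- The class `P_{w,h,a,A}` of probability measures (together with their regression
functions) satisfying (A1), (SMA), and whose Bayes rule belongs to `F_w^(d)`. -/
def Pclass (d : ℕ) (w : ℕ → ℝ) (h a A : ℝ) :
    Set (ProbabilityMeasure (Pt d × ℝ) × (Pt d → ℝ)) :=
  {p | Labels (p.1 : Measure (Pt d × ℝ)) ∧ IsRegression (p.1 : Measure (Pt d × ℝ)) p.2 ∧
       A1cond (p.1 : Measure (Pt d × ℝ)) a A ∧ SMAcond (p.1 : Measure (Pt d × ℝ)) p.2 h ∧
       memFw d w (bayes p.2)}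

end

theorem dyadicI_of_last (j k : ℕ) (hk : k = 2 ^ j - 1) :
    dyadicI j k = Set.Icc ((k : ℝ) / 2 ^ j) (((k : ℝ) + 1) / 2 ^ j) := by
  have h1 : (k : ℝ) + 1 = 2 ^ j := by
    have : k + 1 = 2 ^ j := by have := Nat.one_le_two_pow (n := j); omega
    exact_mod_cast this
  have h2 : (k : ℝ) = 2 ^ j - 1 := by linarith
  have h3 : (2 : ℝ) ^ j ≠ 0 := by positivity
  rw [dyadicI, if_pos hk, h1, h2, div_self h3, sub_div, div_self h3, one_div]

theorem volume_dyadicI (j k : ℕ) : volume (dyadicI j k) = ((2 : ℝ≥0∞) ^ j)⁻¹ := by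
  have h4 : ((k : ℝ) + 1) / 2 ^ j - (k : ℝ) / 2 ^ j = (2 ^ j)⁻¹ := by ring
  have h5 : ENNReal.ofReal ((2 : ℝ) ^ j)⁻¹ = ((2 : ℝ≥0∞) ^ j)⁻¹ := by
    rw [ENNReal.ofReal_inv_of_pos (by positivity), ENNReal.ofReal_pow (by norm_num)]
    norm_num
  by_cases hk : k = 2 ^ j - 1
  · rw [dyadicI_of_last j k hk, Real.volume_Icc, h4, h5]
  · rw [dyadicI, if_neg hk, Real.volume_Ico, h4, h5]

theorem measurableSet_dyadicI (j k : ℕ) : MeasurableSet (dyadicI j k) := by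
  unfold dyadicI
  split_ifs
  exacts [measurableSet_Icc, measurableSet_Ico]

theorem dyadicCube_eq_pi (d j : ℕ) (k : Fin d → ℕ) :
    dyadicCube d j k = Set.univ.pi fun i => dyadicI j (k i) := by
  ext x; simp [dyadicCube]

theorem measurableSet_dyadicCube (d j : ℕ) (k : Fin d → ℕ) :
    MeasurableSet (dyadicCube d j k) := by
  rw [dyadicCube_eq_pi]
  exact MeasurableSet.univ_pi fun i => measurableSet_dyadicI j (k i)

theorem volume_dyadicCube (d j : ℕ) (k : Fin d → ℕ) :
    volume (dyadicCube d j k) = ((2 : ℝ≥0∞) ^ (d * j))⁻¹ := by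
  rw [dyadicCube_eq_pi, volume_pi_pi]
  simp only [volume_dyadicI, Finset.prod_const, Finset.card_univ, Fintype.card_fin]
  rw [mul_comm d j, pow_mul, ENNReal.inv_pow, ENNReal.inv_pow, ENNReal.inv_pow]

/-- For `k < 2 ^ j`, membership in the dyadic interval amounts to having index `k`. -/
theorem mem_dyadicI_iff {j k : ℕ} (hk : k < 2 ^ j) (t : ℝ) :
    t ∈ dyadicI j k ↔ t ∈ Set.Icc (0 : ℝ) 1 ∧ dyadicIdx j t = k := by
  have h2 : (0 : ℝ) < 2 ^ j := by positivity
  have hkR : (k : ℝ) + 1 ≤ 2 ^ j := by exact_mod_cast hk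
  by_cases hl : k = 2 ^ j - 1
  · rw [dyadicI_of_last j k hl]
    have h1 : (k : ℝ) + 1 = 2 ^ j := by
      have : k + 1 = 2 ^ j := by omega
      exact_mod_cast this
    rw [h1, div_self h2.ne', Set.mem_Icc, Set.mem_Icc, dyadicIdx, ← hl, min_eq_right_iff,
      div_le_iff₀ h2]
    constructor
    · rintro ⟨h3, h4⟩
      have h5 : 0 ≤ t * 2 ^ j := le_trans (by positivity) h3
      exact ⟨⟨nonneg_of_mul_nonneg_left h5 h2, h4⟩, Nat.le_floor h3⟩
    · rintro ⟨⟨h3, h4⟩, h5⟩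
      exact ⟨(Nat.le_floor_iff (by positivity)).1 h5, h4⟩
  · rw [dyadicI, if_neg hl, Set.mem_Ico, Set.mem_Icc, div_le_iff₀ h2, lt_div_iff₀ h2]
    have h6 : dyadicIdx j t = k ↔ ⌊t * 2 ^ j⌋₊ = k := by
      unfold dyadicIdx; omega
    rw [h6]
    constructor
    · rintro ⟨h3, h4⟩
      have h5 : 0 ≤ t * 2 ^ j := le_trans (by positivity) h3
      refine ⟨⟨nonneg_of_mul_nonneg_left h5 h2, ?_⟩, (Nat.floor_eq_iff h5).2 ⟨h3, h4⟩⟩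
      nlinarith
    · rintro ⟨⟨h3, -⟩, h5⟩
      exact (Nat.floor_eq_iff (by positivity)).1 h5

theorem dyadicIdx_lt (j : ℕ) (t : ℝ) : dyadicIdx j t < 2 ^ j := by
  have := Nat.one_le_two_pow (n := j)
  unfold dyadicIdx
  omega

theorem dyadicIdx_coarsen {j J : ℕ} (h : j ≤ J) (t : ℝ) :
    dyadicIdx j t = dyadicIdx J t / 2 ^ (J - j) := by
  obtain ⟨r, rfl⟩ := Nat.exists_eq_add_of_le h
  have hfl : ⌊t * 2 ^ j⌋₊ = ⌊t * 2 ^ (j + r)⌋₊ / 2 ^ r := by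
    rw [← Nat.floor_div_natCast]
    congr 1
    push_cast
    field_simp
    ring
  have hlast : 2 ^ j - 1 = (2 ^ (j + r) - 1) / 2 ^ r := by
    have h1 := Nat.one_le_two_pow (n := j)
    have h2 := Nat.one_le_two_pow (n := r)
    symm
    rw [Nat.div_eq_iff (by positivity), pow_add]
    obtain ⟨u, hu⟩ := Nat.exists_eq_add_of_le h1
    rw [hu, Nat.add_sub_cancel_left]
    constructor
    · ring_nf; omega
    · ring_nf; omega
  have hmono : Monotone fun m : ℕ => m / 2 ^ r := fun _ _ hm => Nat.div_le_div_right hm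
  rw [Nat.add_sub_cancel_left, dyadicIdx, dyadicIdx, hfl, hlast]
  exact (hmono.map_min).symm

theorem dyadicCube_subset_unitCube {d j : ℕ} {k : Fin d → ℕ} (hk : ∀ i, k i < 2 ^ j) :
    dyadicCube d j k ⊆ unitCube d := by
  intro x hx
  have h := fun i => ((mem_dyadicI_iff (hk i) (x i)).1 (hx i)).1
  exact ⟨fun i => (h i).1, fun i => (h i).2⟩

theorem lamd_dyadicCube {d j : ℕ} {k : Fin d → ℕ} (hk : ∀ i, k i < 2 ^ j) :
    lamd d (dyadicCube d j k) = ((2 : ℝ≥0∞) ^ (d * j))⁻¹ := by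
  rw [lamd, Measure.restrict_apply (measurableSet_dyadicCube d j k),
    Set.inter_eq_left.2 (dyadicCube_subset_unitCube hk), volume_dyadicCube]

theorem mem_cubeOf_self {d J : ℕ} {x : Pt d} (hx : x ∈ unitCube d) : x ∈ cubeOf d J x :=
  fun i => (mem_dyadicI_iff (dyadicIdx_lt J _) _).2 ⟨⟨hx.1 i, hx.2 i⟩, rfl⟩

/-- Dyadic cubes are nested: a cube of level `j ≤ J` contains the level-`J` cubes of its points. -/
theorem cubeOf_subset_dyadicCube {d j J : ℕ} (h : j ≤ J) {k : Fin d → ℕ}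
    (hk : ∀ i, k i < 2 ^ j) {x : Pt d} (hx : x ∈ dyadicCube d j k) :
    cubeOf d J x ⊆ dyadicCube d j k := by
  intro y hy i
  obtain ⟨-, hxi⟩ := (mem_dyadicI_iff (hk i) (x i)).1 (hx i)
  obtain ⟨hy1, hyi⟩ := (mem_dyadicI_iff (dyadicIdx_lt J (x i)) (y i)).1 (hy i)
  refine (mem_dyadicI_iff (hk i) (y i)).2 ⟨hy1, ?_⟩
  rw [dyadicIdx_coarsen h, hyi, ← dyadicIdx_coarsen h, hxi]

/-- The Lebesgue measure of the part of the cube not covered by the cubes of level at most `J`. -/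
theorem lamd_compl_coarse_le {d : ℕ} {w : ℕ → ℝ} {f : Pt d → ℝ} {T : Set (ℕ × (Fin d → ℕ))}
    (hT : IsDyadicRep d f T)
    (hTw : ∀ j, ((T ∩ {p | p.1 = j}).encard : ℝ≥0∞) ≤ ENNReal.ofReal (w j)) (J : ℕ) :
    lamd d (⋃ p ∈ T ∩ {p | p.1 ≤ J}, dyadicCube d p.1 p.2)ᶜ ≤
      ∑' j : ℕ, ((2 : ℝ≥0∞) ^ (d * (j + J + 1)))⁻¹ * (⌊w (j + J + 1)⌋₊ : ℝ≥0∞) := by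
  obtain ⟨hk, -, hfull, -⟩ := hT
  have hlevel : ∀ j, lamd d (⋃ p ∈ T ∩ {p | p.1 = j}, dyadicCube d p.1 p.2) ≤
      ((2 : ℝ≥0∞) ^ (d * j))⁻¹ * (⌊w j⌋₊ : ℝ≥0∞) := by
    intro j
    have hfin : (T ∩ {p | p.1 = j}).Finite := by
      rw [← Set.encard_ne_top_iff]
      intro htop
      have := hTw j
      rw [htop] at this
      simp at this
    have hcard : hfin.toFinset.card ≤ ⌊w j⌋₊ := by
      have h1 := hTw j
      rw [hfin.encard_eq_coe_toFinset_card] at h1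
      simp only [ENat.toENNReal_coe] at h1
      rcases Nat.eq_zero_or_pos hfin.toFinset.card with h0 | h0
      · omega
      · exact Nat.le_floor ((ENNReal.natCast_le_ofReal h0.ne').1 h1)
    calc lamd d (⋃ p ∈ T ∩ {p | p.1 = j}, dyadicCube d p.1 p.2)
        = lamd d (⋃ p ∈ hfin.toFinset, dyadicCube d p.1 p.2) := by simp
      _ ≤ ∑ p ∈ hfin.toFinset, lamd d (dyadicCube d p.1 p.2) := measure_biUnion_finset_le _ _
      _ = ∑ p ∈ hfin.toFinset, ((2 : ℝ≥0∞) ^ (d * j))⁻¹ := by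
          refine Finset.sum_congr rfl fun p hp => ?_
          obtain ⟨hp1, rfl⟩ := hfin.mem_toFinset.1 hp
          exact lamd_dyadicCube (hk p hp1)
      _ = (hfin.toFinset.card : ℝ≥0∞) * ((2 : ℝ≥0∞) ^ (d * j))⁻¹ := by simp
      _ ≤ _ := by
          rw [mul_comm]
          gcongr
  have hcover : (⋃ p ∈ T ∩ {p | p.1 ≤ J}, dyadicCube d p.1 p.2)ᶜ ⊆
      ((unitCube d)ᶜ ∪ (unitCube d \ ⋃ p ∈ T, dyadicCube d p.1 p.2)) ∪
        ⋃ j : ℕ, ⋃ p ∈ T ∩ {p | p.1 = j + J + 1}, dyadicCube d p.1 p.2 := by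
    intro x hx
    by_cases hxu : x ∈ unitCube d
    · by_cases hxT : x ∈ ⋃ p ∈ T, dyadicCube d p.1 p.2
      · right
        obtain ⟨p, hp, hxp⟩ := Set.mem_iUnion₂.1 hxT
        have hJp : J < p.1 := by
          by_contra hle
          exact hx (Set.mem_iUnion₂.2 ⟨p, ⟨hp, not_lt.1 hle⟩, hxp⟩)
        exact Set.mem_iUnion.2 ⟨p.1 - J - 1, Set.mem_iUnion₂.2
          ⟨p, ⟨hp, show p.1 = p.1 - J - 1 + J + 1 by omega⟩, hxp⟩⟩
      · exact Or.inl (Or.inr ⟨hxu, hxT⟩)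
    · exact Or.inl (Or.inl hxu)
  have hout : lamd d (unitCube d)ᶜ = 0 := by
    exact (Measure.restrict_apply (measurableSet_Icc.compl : MeasurableSet (unitCube d)ᶜ)).trans
      (by rw [unitCube, Set.compl_inter_self, measure_empty])
  calc _ ≤ _ := measure_mono hcover
    _ ≤ _ := measure_union_le _ _
    _ ≤ (0 + 0) + ∑' j : ℕ, lamd d (⋃ p ∈ T ∩ {p | p.1 = j + J + 1}, dyadicCube d p.1 p.2) :=
        add_le_add ((measure_union_le _ _).trans (by rw [hout, hfull])) (measure_iUnion_le _)
    _ ≤ _ := by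
        rw [add_zero, zero_add]
        exact ENNReal.tsum_le_tsum fun j => hlevel (j + J + 1)

theorem cosh_sub_mul_sinh_le {h : ℝ} (hh : 0 ≤ h) :
    Real.cosh h - h * Real.sinh h ≤ Real.exp (-h ^ 2 / 2) := by
  have hd : ∀ x : ℝ, HasDerivAt
      (fun x => Real.exp (x ^ 2 / 2) * (Real.cosh x - x * Real.sinh x))
      (-(Real.exp (x ^ 2 / 2) * (x ^ 2 * Real.sinh x))) x := by
    intro x
    have h1 : HasDerivAt (fun x : ℝ => Real.exp (x ^ 2 / 2)) (Real.exp (x ^ 2 / 2) * x) x := by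
      convert ((hasDerivAt_pow 2 x).div_const 2).exp using 1
      norm_num
    have h2 := (Real.hasDerivAt_cosh x).sub ((hasDerivAt_id x).mul (Real.hasDerivAt_sinh x))
    refine (h1.mul h2).congr_deriv ?_
    simp only [Pi.sub_apply, Pi.mul_apply, id]
    ring
  have hanti : AntitoneOn (fun x => Real.exp (x ^ 2 / 2) * (Real.cosh x - x * Real.sinh x))
      (Set.Ici 0) := by
    refine antitoneOn_of_deriv_nonpos (convex_Ici 0)
      (fun x _ => (hd x).continuousAt.continuousWithinAt)
      (fun x _ => (hd x).differentiableAt.differentiableWithinAt) fun x hx => ?_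
    rw [interior_Ici] at hx
    rw [(hd x).deriv, neg_nonpos]
    have := Real.sinh_nonneg_iff.2 (le_of_lt hx)
    positivity
  have h0 := hanti (Set.mem_Ici.2 le_rfl) (Set.mem_Ici.2 hh) hh
  norm_num at h0
  have h3 : Real.exp (-h ^ 2 / 2) * Real.exp (h ^ 2 / 2) = 1 := by
    rw [← Real.exp_add, neg_div, neg_add_cancel, Real.exp_zero]
  have h4 := mul_le_mul_of_nonneg_left h0 (Real.exp_pos (-h ^ 2 / 2)).le
  rwa [← mul_assoc, h3, one_mul, mul_one] at h4

theorem cnt_eq_sum (n : ℕ) (P : Fin n → Prop) [DecidablePred P] :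
    cnt n P = ∑ i, if P i then 1 else 0 := by
  rw [cnt, Nat.card_eq_fintype_card, Fintype.card_subtype, Finset.card_filter]

/-- If the majority vote at `x` differs from `v`, then the votes `-v` are at least as many as the
votes `v` in the cube of `x`. -/
theorem cnt_le_of_fhat_ne {d J n : ℕ} {s : Fin n → Pt d × ℝ} {x : Pt d} {v : ℝ}
    (hv : v = 1 ∨ v = -1) (hne : fhat d J n s x ≠ v) :
    cnt n (fun i => s i ∈ cubeOf d J x ×ˢ {v}) ≤ cnt n (fun i => s i ∈ cubeOf d J x ×ˢ {-v}) := by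
  classical
  simp only [Set.mem_prod, Set.mem_singleton_iff]
  rcases hv with rfl | rfl
  · by_contra hlt
    rw [not_le] at hlt
    refine hne (if_pos ⟨?_, hlt⟩)
    by_contra hno
    push Not at hno
    simp [cnt, hno] at hlt
  · rw [neg_neg]
    by_contra hlt
    exact hne (if_neg fun hc => hlt hc.2.le)

theorem measurable_cnt {Ω : Type*} [MeasurableSpace Ω] {n : ℕ} {S : Fin n → Set Ω}
    (hS : ∀ i, MeasurableSet (S i)) : Measurable fun s : Ω => cnt n fun i => s ∈ S i := by
  classical
  simp only [cnt_eq_sum]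
  exact Finset.measurable_sum _ fun i _ => Measurable.ite (hS i) measurable_const measurable_const

theorem measurable_dyadicIdx (J : ℕ) : Measurable (dyadicIdx J) :=
  (Nat.measurable_floor.comp (measurable_id.mul_const _)).min measurable_const

theorem measurable_fhat (d J n : ℕ) :
    Measurable fun p : (Fin n → Pt d × ℝ) × Pt d => fhat d J n p.1 p.2 := by
  classical
  have hg : Measurable fun q : (Fin n → Pt d × ℝ) × (Fin d → ℕ) =>
      if (∃ i, (q.1 i).1 ∈ dyadicCube d J q.2) ∧
        cnt n (fun i => (q.1 i).1 ∈ dyadicCube d J q.2 ∧ (q.1 i).2 = -1) <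
          cnt n (fun i => (q.1 i).1 ∈ dyadicCube d J q.2 ∧ (q.1 i).2 = 1)
      then (1 : ℝ) else -1 := by
    refine measurable_from_prod_countable_left fun k => ?_
    have hC := measurableSet_dyadicCube d J k
    have hX : ∀ i : Fin n, MeasurableSet {s : Fin n → Pt d × ℝ | (s i).1 ∈ dyadicCube d J k} :=
      fun i => (measurable_fst.comp (measurable_pi_apply i)) hC
    have hc : ∀ y : ℝ, Measurable fun s : Fin n → Pt d × ℝ =>
        cnt n fun i => (s i).1 ∈ dyadicCube d J k ∧ (s i).2 = y := fun y =>
      measurable_cnt (S := fun i => {s : Fin n → Pt d × ℝ |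
        (s i).1 ∈ dyadicCube d J k ∧ (s i).2 = y}) fun i =>
          (hX i).inter ((measurable_snd.comp (measurable_pi_apply i)) (measurableSet_singleton y))
    have hex : MeasurableSet {s : Fin n → Pt d × ℝ | ∃ i, (s i).1 ∈ dyadicCube d J k} := by
      rw [Set.ofPred_exists]
      exact MeasurableSet.iUnion hX
    exact Measurable.ite (hex.inter (measurableSet_lt (hc (-1)) (hc 1)))
      measurable_const measurable_const
  exact hg.comp (measurable_fst.prodMk (measurable_pi_lambda _ fun i =>
    (measurable_dyadicIdx J).comp ((measurable_pi_apply i).comp measurable_snd)))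

section Margin

variable {d : ℕ} {π : Measure (Pt d × ℝ)} [IsProbabilityMeasure π] {η : Pt d → ℝ} {h : ℝ}
  {I : Set (Pt d)}

instance isProbabilityMeasure_margX : IsProbabilityMeasure (margX π) :=
  Measure.isProbabilityMeasure_map measurable_fst.aemeasurable

theorem measureReal_prod_one_add_neg_one (hL : Labels π) (hI : MeasurableSet I) :
    π.real (I ×ˢ {1}) + π.real (I ×ˢ {-1}) = (margX π).real I := by
  have hlab : ∀ᵐ p ∂π, p.2 = 1 ∨ p.2 = -1 := by
    refine (mem_ae_iff_prob_eq_one ?_).2 hL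
    exact (measurable_snd (measurableSet_singleton (1 : ℝ))).union
      (measurable_snd (measurableSet_singleton (-1 : ℝ)))
  rw [← measureReal_union (by
    rw [Set.disjoint_left]
    rintro p ⟨-, h1⟩ ⟨-, h2⟩
    rw [Set.mem_singleton_iff] at h1 h2
    linarith) (hI.prod (measurableSet_singleton _)),
    margX, map_measureReal_apply measurable_fst hI]
  refine measureReal_congr ?_
  filter_upwards [hlab] with p hp
  refine propext ⟨?_, fun hpI => ?_⟩
  · rintro (h1 | h1) <;> exact h1.1
  · exact hp.imp (fun h1 => ⟨hpI, h1⟩) fun h1 => ⟨hpI, h1⟩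

/-- Under the margin assumption, a set on which the Bayes rule is `v` carries at least a fraction
`(1 + h) / 2` of labels `v`. -/
theorem margin_le_measureReal_prod (hL : Labels π) (hη : IsRegression π η)
    (hSMA : SMAcond π η h) (hI : MeasurableSet I) {v : ℝ} (hv : v = 1 ∨ v = -1)
    (hbI : ∀ x ∈ I, bayes η x = v) :
    (1 + h) / 2 * (margX π).real I ≤ π.real (I ×ˢ {v}) := by
  obtain ⟨hm, h01, hreg⟩ := hη
  have hae : ∀ᵐ x ∂(margX π), h ≤ |2 * η x - 1| := by
    refine (mem_ae_iff_prob_eq_one ?_).2 hSMA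
    exact measurableSet_le measurable_const ((hm.const_mul 2).sub_const 1).abs
  have hint : Integrable η (margX π) :=
    Integrable.of_bound hm.aestronglyMeasurable 1 (Filter.Eventually.of_forall fun x => by
      rw [Real.norm_eq_abs, abs_of_nonneg (h01 x).1]; exact (h01 x).2)
  have hone : π.real (I ×ˢ {1}) = ∫ x in I, η x ∂(margX π) := by
    rw [measureReal_def, hreg I hI, integral_eq_lintegral_of_nonneg_ae
      (Filter.Eventually.of_forall fun x => (h01 x).1) hm.aestronglyMeasurable]
  have hconst : ∀ c : ℝ, ∫ _ in I, c ∂(margX π) = c * (margX π).real I := fun c => by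
    rw [setIntegral_const, smul_eq_mul, mul_comm]
  have hadd := measureReal_prod_one_add_neg_one hL hI
  rcases hv with rfl | rfl
  · rw [hone, ← hconst]
    refine setIntegral_mono_on_ae (integrable_const _).integrableOn hint.integrableOn hI ?_
    filter_upwards [hae] with x hx hxI
    have hb := hbI x hxI
    have hx2 : 1 / 2 ≤ η x := by
      by_contra hc
      rw [bayes, if_neg hc] at hb
      norm_num at hb
    rw [abs_of_nonneg (by linarith)] at hx
    linarith
  · have hle : π.real (I ×ˢ {1}) ≤ (1 - h) / 2 * (margX π).real I := by
      rw [hone, ← hconst]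
      refine setIntegral_mono_on_ae hint.integrableOn (integrable_const _).integrableOn hI ?_
      filter_upwards [hae] with x hx hxI
      have hb := hbI x hxI
      have hx2 : ¬ 1 / 2 ≤ η x := by
        intro hc
        rw [bayes, if_pos hc] at hb
        norm_num at hb
      rw [abs_of_nonpos (by linarith)] at hx
      linarith
    linarith

/-- The exponential moment of a signed vote restricted to a set where the Bayes rule is `v`. -/
theorem integral_exp_vote_le (hL : Labels π) (hη : IsRegression π η) (hh : 0 ≤ h)
    (hSMA : SMAcond π η h) (hI : MeasurableSet I) {v : ℝ} (hv : v = 1 ∨ v = -1)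
    (hbI : ∀ x ∈ I, bayes η x = v) :
    Integrable (fun p => Real.exp (h * ((I ×ˢ {-v}).indicator 1 p - (I ×ˢ {v}).indicator 1 p))) π ∧
    ∫ p, Real.exp (h * ((I ×ˢ {-v}).indicator 1 p - (I ×ˢ {v}).indicator 1 p)) ∂π ≤
      Real.exp (-((margX π).real I * (1 - Real.exp (-h ^ 2 / 2)))) := by
  classical
  have hS : ∀ y : ℝ, MeasurableSet (I ×ˢ {y}) := fun y => hI.prod (measurableSet_singleton y)
  have heq : (fun p : Pt d × ℝ =>
      Real.exp (h * ((I ×ˢ {-v}).indicator 1 p - (I ×ˢ {v}).indicator 1 p))) =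
      fun p => 1 + (I ×ˢ {-v}).indicator (fun _ => Real.exp h - 1) p +
        (I ×ˢ {v}).indicator (fun _ => Real.exp (-h) - 1) p := by
    funext p
    have hdisj : ¬ (p ∈ I ×ˢ {v} ∧ p ∈ I ×ˢ {-v}) := by
      rintro ⟨⟨-, h1⟩, -, h2⟩
      rw [Set.mem_singleton_iff] at h1 h2
      rcases hv with rfl | rfl <;> linarith
    by_cases h1 : p ∈ I ×ˢ {v} <;> by_cases h2 : p ∈ I ×ˢ {-v}
    · exact absurd ⟨h1, h2⟩ hdisj
    all_goals simp only [Set.indicator_of_mem, Set.indicator_of_notMem, h1, h2,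
      not_false_eq_true, Pi.one_apply]
    all_goals simp
  have hi : ∀ y c : ℝ, Integrable ((I ×ˢ {y}).indicator fun _ => c) π := fun y c =>
    (integrable_const c).indicator (hS y)
  have hadd : π.real (I ×ˢ {v}) + π.real (I ×ˢ {-v}) = (margX π).real I := by
    have := measureReal_prod_one_add_neg_one hL hI
    rcases hv with rfl | rfl
    · exact this
    · rw [neg_neg, add_comm, this]
  have hmar := margin_le_measureReal_prod hL hη hSMA hI hv hbI
  rw [heq]
  refine ⟨((integrable_const 1).add (hi _ _)).add (hi _ _), ?_⟩
  rw [integral_add (f := fun p => 1 + (I ×ˢ {-v}).indicator (fun _ => Real.exp h - 1) p)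
      ((integrable_const 1).add (hi _ _)) (hi _ _),
    integral_add (integrable_const 1) (hi _ _), integral_indicator_const _ (hS _),
    integral_indicator_const _ (hS _), integral_const]
  simp only [probReal_univ, smul_eq_mul, one_mul]
  have hcs := mul_le_mul_of_nonneg_left (cosh_sub_mul_sinh_le hh)
    (measureReal_nonneg : 0 ≤ (margX π).real I)
  have hmono : 0 ≤ Real.exp h - Real.exp (-h) := sub_nonneg.2 (Real.exp_le_exp.2 (by linarith))
  have h1 := mul_le_mul_of_nonneg_right hmar hmono
  rw [Real.cosh_eq, Real.sinh_eq] at hcs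
  have h2 := Real.add_one_le_exp (-((margX π).real I * (1 - Real.exp (-h ^ 2 / 2))))
  have h3 : π.real (I ×ˢ {-v}) = (margX π).real I - π.real (I ×ˢ {v}) := by linarith
  rw [h3]
  linarith

/-- Chernoff bound for the probability that the vote at `x` differs from the Bayes rule. -/
theorem sampM_fhat_ne_le (hL : Labels π) (hη : IsRegression π η) (hh : 0 ≤ h)
    (hSMA : SMAcond π η h) {J : ℕ} (n : ℕ) {x : Pt d} {v : ℝ} (hv : v = 1 ∨ v = -1)
    (hbI : ∀ y ∈ cubeOf d J x, bayes η y = v) :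
    (sampM π n).real {s | fhat d J n s x ≠ v} ≤
      Real.exp (-(n * (margX π).real (cubeOf d J x) * (1 - Real.exp (-h ^ 2 / 2)))) := by
  classical
  have hI : MeasurableSet (cubeOf d J x) := measurableSet_dyadicCube d J _
  obtain ⟨hint, hle⟩ := integral_exp_vote_le hL hη hh hSMA hI hv hbI
  set φ : Pt d × ℝ → ℝ := fun p => Real.exp
    (h * ((cubeOf d J x ×ˢ {-v}).indicator 1 p - (cubeOf d J x ×ˢ {v}).indicator 1 p)) with hφ
  have hφ0 : ∀ p, 0 ≤ φ p := fun p => (Real.exp_pos _).le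
  have hsub : {s : Fin n → Pt d × ℝ | fhat d J n s x ≠ v} ⊆ {s | 1 ≤ ∏ i, φ (s i)} := by
    intro s hs
    have hcnt := cnt_le_of_fhat_ne hv hs
    have hcast : ∀ y : ℝ, ((cnt n fun i => s i ∈ cubeOf d J x ×ˢ {y} : ℕ) : ℝ) =
        ∑ i, (cubeOf d J x ×ˢ {y}).indicator (1 : Pt d × ℝ → ℝ) (s i) := fun y => by
      rw [cnt_eq_sum]
      push_cast
      simp only [Set.indicator_apply, Pi.one_apply]
    have hcnt' := (Nat.cast_le (α := ℝ)).2 hcnt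
    rw [hcast, hcast] at hcnt'
    rw [Set.mem_ofPred_eq, hφ, ← Real.exp_sum, ← Finset.mul_sum, Finset.sum_sub_distrib]
    exact Real.one_le_exp (mul_nonneg hh (sub_nonneg.2 hcnt'))
  have hprob : IsProbabilityMeasure (sampM π n) := by unfold sampM; infer_instance
  calc (sampM π n).real {s | fhat d J n s x ≠ v}
      ≤ (sampM π n).real {s | 1 ≤ ∏ i, φ (s i)} := measureReal_mono hsub
    _ ≤ ∫ s, ∏ i, φ (s i) ∂(sampM π n) := by
        rw [← one_mul ((sampM π n).real _)]
        exact mul_meas_ge_le_integral_of_nonneg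
          (Filter.Eventually.of_forall fun s => Finset.prod_nonneg fun i _ => hφ0 _)
          (Integrable.fintype_prod fun _ => hint) 1
    _ = (∫ p, φ p ∂π) ^ n := by
        rw [sampM, integral_fintype_prod_eq_pow, Fintype.card_fin]
    _ ≤ Real.exp (-((margX π).real (cubeOf d J x) * (1 - Real.exp (-h ^ 2 / 2)))) ^ n :=
        pow_le_pow_left₀ (integral_nonneg hφ0) hle n
    _ = _ := by
        rw [← Real.exp_nat_mul]
        ring_nf

/-- The excess risk is at most the probability of disagreement. -/
theorem risk_le_risk_add {f g : Pt d → ℝ} (hfg : MeasurableSet {x | f x ≠ g x}) :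
    risk π f ≤ risk π g + (margX π).real {x | f x ≠ g x} := by
  have hsub : {p : Pt d × ℝ | f p.1 ≠ p.2} ⊆
      {p | g p.1 ≠ p.2} ∪ Prod.fst ⁻¹' {x | f x ≠ g x} := by
    intro p hp
    by_cases hg : g p.1 = p.2
    · exact Or.inr (by simpa [hg] using hp)
    · exact Or.inl hg
  rw [margX, map_measureReal_apply measurable_fst hfg]
  exact (measureReal_mono hsub).trans (measureReal_union_le _ _)

/-- If, off a set of probability at most `δ`, the classifier differs from the Bayes rule with
probability at most `c`, then its expected excess risk is at most `δ + c`. -/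
theorem excessExp_le {n : ℕ} {F : (Fin n → Pt d × ℝ) → Pt d → ℝ} {δ c : ℝ} {G : Set (Pt d)}
    (hη : Measurable (bayes η))
    (hF : Measurable fun p : (Fin n → Pt d × ℝ) × Pt d => F p.1 p.2) (hG : MeasurableSet G)
    (hGδ : (margX π).real Gᶜ ≤ δ) (hc : 0 ≤ c)
    (hFc : ∀ x ∈ G, (sampM π n).real {s | F s x ≠ bayes η x} ≤ c) :
    excessExp π η n F ≤ δ + c := by
  have hprob : IsProbabilityMeasure (sampM π n) := by unfold sampM; infer_instance
  set E : Set ((Fin n → Pt d × ℝ) × Pt d) := {p | F p.1 p.2 ≠ bayes η p.2}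
  have hEm : MeasurableSet E := (measurableSet_eq_fun hF (hη.comp measurable_snd)).compl
  have hdis : ∫ s, (margX π).real {x | F s x ≠ bayes η x} ∂(sampM π n) =
      ∫ x, (sampM π n).real {s | F s x ≠ bayes η x} ∂(margX π) := by
    simp only [measureReal_def]
    rw [integral_toReal (f := fun s => margX π {x | F s x ≠ bayes η x})
        (measurable_measure_prodMk_left hEm).aemeasurable
        (Filter.Eventually.of_forall fun _ => measure_lt_top _ _),
      integral_toReal (f := fun x => sampM π n {s | F s x ≠ bayes η x})
        (measurable_measure_prodMk_right hEm).aemeasurable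
        (Filter.Eventually.of_forall fun _ => measure_lt_top _ _)]
    congr 1
    exact (Measure.prod_apply hEm).symm.trans (Measure.prod_apply_symm hEm)
  have hintD : Integrable (fun s => (margX π).real {x | F s x ≠ bayes η x}) (sampM π n) :=
    Integrable.of_bound
      (measurable_measure_prodMk_left hEm).ennreal_toReal.aestronglyMeasurable 1
      (Filter.Eventually.of_forall fun s => by
        rw [Real.norm_eq_abs, abs_of_nonneg measureReal_nonneg]
        exact measureReal_le_one)
  have hrisk : ∫ s, risk π (F s) ∂(sampM π n) ≤
      ∫ s, (risk π (bayes η) + (margX π).real {x | F s x ≠ bayes η x}) ∂(sampM π n) :=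
    integral_mono_of_nonneg (Filter.Eventually.of_forall fun _ => ENNReal.toReal_nonneg)
      ((integrable_const _).add hintD)
      (Filter.Eventually.of_forall fun s => risk_le_risk_add (measurable_prodMk_left hEm))
  rw [integral_add (integrable_const _) hintD, integral_const, probReal_univ, one_smul,
    hdis] at hrisk
  have hbound : ∫ x, (sampM π n).real {s | F s x ≠ bayes η x} ∂(margX π) ≤
      ∫ x, (Gᶜ.indicator 1 x + c) ∂(margX π) := by
    refine integral_mono_of_nonneg (Filter.Eventually.of_forall fun _ => measureReal_nonneg)
      (((integrable_const 1).indicator hG.compl).add (integrable_const c))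
      (Filter.Eventually.of_forall fun x => ?_)
    by_cases hx : x ∈ G
    · simpa [hx] using hFc x hx
    · have : (sampM π n).real {s | F s x ≠ bayes η x} ≤ 1 := measureReal_le_one
      simp only [Set.indicator_of_mem (Set.mem_compl hx), Pi.one_apply]
      linarith
  rw [integral_add (f := Gᶜ.indicator 1) ((integrable_const 1).indicator hG.compl)
      (integrable_const c),
    integral_indicator_one hG.compl, integral_const, probReal_univ, one_smul] at hbound
  unfold excessExp
  linarith

end Margin

/-- **Estimation Theorem.** Under (A1), (SMA) and `f* ∈ F_w^(d)`,
the dyadic majority-vote classifier at the smallest level `J_ε` with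
`∑_{j>J_ε} 2^{-dj}⌊w(j)⌋ < ε/A` satisfies
`E[R(f̂) - R(f*)] ≤ (1+A)ε + exp(-n a (1 - e^{-h²/2}) 2^{-dJ_ε})`. -/
theorem estimation_theorem (d : ℕ) (hd : 1 ≤ d) (w : ℕ → ℝ) (hw : ∀ j, 0 ≤ w j)
    (hsum : ∑' j : ℕ, ((2 : ℝ≥0∞) ^ (d * j))⁻¹ * (⌊w j⌋₊ : ℝ≥0∞) < ⊤)
    (π : Measure (Pt d × ℝ)) [IsProbabilityMeasure π] (hL : Labels π)
    (η : Pt d → ℝ) (hη : IsRegression π η)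
    (a A h : ℝ) (ha : 0 < a) (ha1 : a ≤ 1) (hA : 1 ≤ A) (hh : 0 < h) (hh1 : h ≤ 1)
    (hA1 : A1cond π a A) (hSMA : SMAcond π η h) (hb : memFw d w (bayes η))
    (n : ℕ) (hn : 1 ≤ n) (ε : ℝ) (hε : 0 < ε) (Jε : ℕ)
    (hJ1 : ∑' j : ℕ, ((2 : ℝ≥0∞) ^ (d * (j + Jε + 1)))⁻¹ * (⌊w (j + Jε + 1)⌋₊ : ℝ≥0∞) <
      ENNReal.ofReal (ε / A))
    (hJ2 : ∀ J' : ℕ, J' < Jε →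
      ¬ (∑' j : ℕ, ((2 : ℝ≥0∞) ^ (d * (j + J' + 1)))⁻¹ * (⌊w (j + J' + 1)⌋₊ : ℝ≥0∞) <
        ENNReal.ofReal (ε / A))) :
    excessExp π η n (fhat d Jε n) ≤
      (1 + A) * ε +
        Real.exp (-(n : ℝ) * a * (1 - Real.exp (-h ^ 2 / 2)) * ((2 : ℝ) ^ (d * Jε))⁻¹) := by
  obtain ⟨hbm, hb1, T, hT, hTw⟩ := hb
  set G : Set (Pt d) := ⋃ p ∈ T ∩ {p | p.1 ≤ Jε}, dyadicCube d p.1 p.2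
  have hG : MeasurableSet G :=
    MeasurableSet.biUnion (Set.to_countable _) fun p _ => measurableSet_dyadicCube d p.1 p.2
  have hA0 : 0 < A := by linarith
  have hGε : (margX π).real Gᶜ ≤ ε := by
    refine ENNReal.toReal_le_of_le_ofReal hε.le ((hA1 _ hG.compl).2.trans ?_)
    calc ENNReal.ofReal A * lamd d Gᶜ ≤ ENNReal.ofReal A * ENNReal.ofReal (ε / A) := by
          gcongr
          exact (lamd_compl_coarse_le hT hTw Jε).trans hJ1.le
      _ = ENNReal.ofReal ε := by
          rw [← ENNReal.ofReal_mul hA0.le, mul_div_cancel₀ _ hA0.ne']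
  have hpoint : ∀ x ∈ G, (sampM π n).real {s | fhat d Jε n s x ≠ bayes η x} ≤
      Real.exp (-(n : ℝ) * a * (1 - Real.exp (-h ^ 2 / 2)) * ((2 : ℝ) ^ (d * Jε))⁻¹) := by
    intro x hx
    obtain ⟨p, ⟨hpT, hpJ⟩, hxp⟩ := Set.mem_iUnion₂.1 hx
    have hconst : ∀ y ∈ cubeOf d Jε x, bayes η y = bayes η x := fun y hy =>
      hT.2.2.2 p hpT y (cubeOf_subset_dyadicCube hpJ (hT.1 p hpT) hxp hy) x hxp
    refine (sampM_fhat_ne_le hL hη hh.le hSMA n (hb1 x) hconst).trans (Real.exp_le_exp.2 ?_)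
    have hmass : a * ((2 : ℝ) ^ (d * Jε))⁻¹ ≤ (margX π).real (cubeOf d Jε x) := by
      have h1 := (hA1 _ (measurableSet_dyadicCube d Jε fun i => dyadicIdx Jε (x i))).1
      rw [lamd_dyadicCube fun i => dyadicIdx_lt Jε (x i)] at h1
      have h2 := ENNReal.toReal_mono (measure_ne_top _ _) h1
      simpa [measureReal_def, cubeOf, ENNReal.toReal_ofReal ha.le] using h2
    have hexp : 0 ≤ 1 - Real.exp (-h ^ 2 / 2) := by
      rw [sub_nonneg, Real.exp_le_one_iff]
      nlinarith [sq_nonneg h]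
    have h3 := mul_le_mul_of_nonneg_left hmass (mul_nonneg (Nat.cast_nonneg (α := ℝ) n) hexp)
    linarith
  refine (excessExp_le hbm (measurable_fhat d Jε n) hG hGε (Real.exp_pos _).le hpoint).trans ?_
  nlinarith [mul_pos hA0 hε]
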